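/- Let N ≥ 1, m ≥ 1, γ > 0, and 0 ≤ ε < γ/2. Let B₀,…,B_N be m×m real matrices with ⟨x, B₀·x⟩ ≤ −γ·‖x‖² for all x ∈ ℝ^m and ‖Bₙ·x‖ ≤ (γ/N)·‖x‖ for all x and all 1 ≤ n ≤ N. Let G : ℝ → (linear endomorphisms of (ℝ^m)^{N+1}) be such that ⟨D, G(t)·D⟩ ≤ ε·‖D‖² for all t and all D ∈ (ℝ^m)^{N+1}, where ‖D‖² := Σ_{n=0}^{N} ‖Dₙ‖². Suppose D : ℝ → (ℝ^m)^{N+1} is differentiable and satisfies, for all t ≥ 0 and each 0 ≤ n ≤ N, Dₙ'(t) = Σ_{k=0}^{N−n} B_k·D_{n+k}(t) + (G(t)·D(t))ₙ. Then ‖D(t)‖ ≤ ‖D(0)‖ · e^{−(γ/2 − ε)·t} for all t ≥ 0. -/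

import Mathlib

open Finset

/-- Euclidean inner product on `ℝ^m`. -/
def einner {m : ℕ} (x y : Fin m → ℝ) : ℝ := ∑ i, x i * y i

/-- Euclidean norm on `ℝ^m`. -/
noncomputable def enorm' {m : ℕ} (x : Fin m → ℝ) : ℝ := Real.sqrt (∑ i, x i ^ 2)

/-- Block Euclidean inner product on `(ℝ^m)^{N+1}`. -/
def binner {N m : ℕ} (x y : Fin (N + 1) → Fin m → ℝ) : ℝ :=
  ∑ n, einner (x n) (y n)

/-- Block Euclidean norm on `(ℝ^m)^{N+1}`, with `‖D‖² = Σₙ ‖Dₙ‖²`. -/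
noncomputable def bnorm {N m : ℕ} (x : Fin (N + 1) → Fin m → ℝ) : ℝ :=
  Real.sqrt (∑ n, ∑ i, x n i ^ 2)

lemma enorm_sq_aux {m : ℕ} (x : Fin m → ℝ) : enorm' x ^ 2 = ∑ i, x i ^ 2 :=
  Real.sq_sqrt (Finset.sum_nonneg fun i _ => sq_nonneg _)

lemma bnorm_sq_aux {N m : ℕ} (x : Fin (N + 1) → Fin m → ℝ) :
    bnorm x ^ 2 = ∑ n, ∑ i, x n i ^ 2 :=
  Real.sq_sqrt (Finset.sum_nonneg fun n _ => Finset.sum_nonneg fun i _ => sq_nonneg _)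

lemma einner_le_aux {m : ℕ} (x y : Fin m → ℝ) : einner x y ≤ enorm' x * enorm' y :=
  Real.sum_mul_le_sqrt_mul_sqrt _ _ _

lemma einner_add_aux {m : ℕ} (x y z : Fin m → ℝ) :
    einner x (y + z) = einner x y + einner x z := by
  simp [einner, mul_add, Finset.sum_add_distrib]

lemma einner_sum_aux {m : ℕ} {ι : Type*} (s : Finset ι) (x : Fin m → ℝ) (y : ι → Fin m → ℝ) :
    einner x (∑ j ∈ s, y j) = ∑ j ∈ s, einner x (y j) := by
  simp only [einner, Finset.sum_apply, Finset.mul_sum]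
  exact Finset.sum_comm

lemma triangle_sum_aux {N : ℕ} (a : Fin (N + 1) → ℝ) :
    2 * ∑ n, ∑ ν ∈ Finset.Icc n (Fin.last N), a n * a ν ≤ ((N : ℝ) + 2) * ∑ n, a n ^ 2 := by
  have h1 : ∀ n : Fin (N + 1), ∑ ν ∈ Finset.Icc n (Fin.last N), a n * a ν
      = ∑ ν, if n ≤ ν then a n * a ν else 0 := by
    intro n
    rw [← Finset.sum_filter]
    refine Finset.sum_congr ?_ fun _ _ => rfl
    ext ν
    simp [Fin.le_last]
  have h2 : ∑ n, ∑ ν, (if n ≤ ν then a n * a ν else 0)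
      = ∑ n, ∑ ν, (if ν ≤ n then a n * a ν else 0) := by
    rw [Finset.sum_comm]
    simp only [mul_comm]
  have h3 : (∑ n, ∑ ν, (if n ≤ ν then a n * a ν else 0))
      + ∑ n, ∑ ν, (if ν ≤ n then a n * a ν else 0)
      = (∑ n, a n) ^ 2 + ∑ n, a n ^ 2 := by
    have h4 : ∑ n, a n ^ 2 = ∑ n, ∑ ν, (if n = ν then a n * a ν else 0) := by
      simp [sq]
    rw [h4, sq, Finset.sum_mul_sum, ← Finset.sum_add_distrib, ← Finset.sum_add_distrib]
    refine Finset.sum_congr rfl fun n _ => ?_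
    rw [← Finset.sum_add_distrib, ← Finset.sum_add_distrib]
    refine Finset.sum_congr rfl fun ν _ => ?_
    rcases lt_trichotomy n ν with h | h | h
    · simp [h.le, h.not_ge, h.ne]
    · simp [h]
    · simp [h.le, h.not_ge, h.ne']
  have h5 : (∑ n, a n) ^ 2 ≤ ((N : ℝ) + 1) * ∑ n, a n ^ 2 := by
    have := sq_sum_le_card_mul_sum_sq (s := Finset.univ) (f := a)
    simpa using this
  simp only [h1]
  linarith

/-- Rate of emergence: the stable variables governed by the block upper-triangular
Toeplitz operator with coercive diagonal `B₀`, small off-diagonal blocks, and a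
time-dependent perturbation `G(t)` with quadratic form bounded by `ε < γ/2`, decay
at exponential rate at least `γ/2 − ε`. -/
theorem rate_of_emergence
    (N m : ℕ) (hN : 1 ≤ N) (hm : 1 ≤ m) (γ ε : ℝ) (hγ : 0 < γ)
    (hε0 : 0 ≤ ε) (hε : ε < γ / 2)
    (B : ℕ → Matrix (Fin m) (Fin m) ℝ)
    (hB0 : ∀ x : Fin m → ℝ, einner x ((B 0).mulVec x) ≤ -γ * enorm' x ^ 2)
    (hBn : ∀ n, 1 ≤ n → n ≤ N →
      ∀ x : Fin m → ℝ, enorm' ((B n).mulVec x) ≤ (γ / N) * enorm' x)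
    (G : ℝ → (Fin (N + 1) → Fin m → ℝ) →ₗ[ℝ] (Fin (N + 1) → Fin m → ℝ))
    (hG : ∀ (t : ℝ) (D : Fin (N + 1) → Fin m → ℝ),
      binner D (G t D) ≤ ε * bnorm D ^ 2)
    (D : ℝ → Fin (N + 1) → Fin m → ℝ)
    (hD : Differentiable ℝ D)
    (hode : ∀ t ≥ (0:ℝ), ∀ n : Fin (N + 1),
      deriv (fun τ => D τ n) t
        = (∑ ν ∈ Finset.Icc n (Fin.last N),
            (B ((ν : ℕ) - (n : ℕ))).mulVec (D t ν)) + G t (D t) n) :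
    ∀ t ≥ (0:ℝ), bnorm (D t) ≤ bnorm (D 0) * Real.exp (-(γ / 2 - ε) * t) := by
  have hNpos : (0:ℝ) < N := by exact_mod_cast hN
  have key : ∀ t ≥ (0:ℝ), binner (D t) (fun n => deriv (fun τ => D τ n) t)
      ≤ -(γ / 2 - ε) * bnorm (D t) ^ 2 := by
    intro t ht
    have hS : bnorm (D t) ^ 2 = ∑ n, enorm' (D t n) ^ 2 := by
      simp only [bnorm_sq_aux, enorm_sq_aux]
    have h1 : binner (D t) (fun n => deriv (fun τ => D τ n) t)
        = (∑ n : Fin (N + 1), ∑ ν ∈ Finset.Icc n (Fin.last N),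
            einner (D t n) ((B ((ν : ℕ) - (n : ℕ))).mulVec (D t ν)))
          + binner (D t) (G t (D t)) := by
      simp only [binner, hode t ht, einner_add_aux, einner_sum_aux, Finset.sum_add_distrib]
    have h2 : ∀ n : Fin (N + 1), ∑ ν ∈ Finset.Icc n (Fin.last N),
          einner (D t n) ((B ((ν : ℕ) - (n : ℕ))).mulVec (D t ν))
        ≤ γ / N * (∑ ν ∈ Finset.Icc n (Fin.last N), enorm' (D t n) * enorm' (D t ν))
          - (γ + γ / N) * enorm' (D t n) ^ 2 := by
      intro n
      have h3 : (γ + γ / N) * enorm' (D t n) ^ 2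
          = ∑ ν ∈ Finset.Icc n (Fin.last N),
            if n = ν then (γ + γ / N) * enorm' (D t n) ^ 2 else 0 := by
        rw [Finset.sum_ite_eq]
        simp [Fin.le_last]
      rw [h3, Finset.mul_sum, ← Finset.sum_sub_distrib]
      refine Finset.sum_le_sum fun ν hν => ?_
      have hle : n ≤ ν := (Finset.mem_Icc.1 hν).1
      by_cases h : n = ν
      · subst h
        have := hB0 (D t n)
        simp only [Nat.sub_self, if_true]
        nlinarith
      · simp only [h, if_false, sub_zero]
        have hlt : (n : ℕ) < ν := lt_of_le_of_ne hle (fun h' => h (Fin.ext h'))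
        have hν2 := ν.2
        have h4 := hBn ((ν : ℕ) - n) (by omega) (by omega) (D t ν)
        calc _ ≤ _ := einner_le_aux _ _
          _ ≤ enorm' (D t n) * ((γ / N) * enorm' (D t ν)) :=
            mul_le_mul_of_nonneg_left h4 (Real.sqrt_nonneg _)
          _ = _ := by ring
    have h5 := Finset.sum_le_sum fun n (_ : n ∈ (Finset.univ : Finset (Fin (N + 1)))) => h2 n
    rw [Finset.sum_sub_distrib, ← Finset.mul_sum, ← Finset.mul_sum, ← hS] at h5
    have h6 := triangle_sum_aux (fun n => enorm' (D t n))
    rw [← hS] at h6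
    have h7 := mul_le_mul_of_nonneg_left h6 (div_pos hγ hNpos).le
    have h8 : γ / N * (((N : ℝ) + 2) * bnorm (D t) ^ 2)
        = (γ + 2 * (γ / N)) * bnorm (D t) ^ 2 := by
      field_simp
    have h9 := hG t (D t)
    rw [h1]
    linarith
  have hder : ∀ t, HasDerivAt (fun τ => bnorm (D τ) ^ 2)
      (2 * binner (D t) (fun n => deriv (fun τ => D τ n) t)) t := by
    intro t
    simp only [bnorm_sq_aux, binner, einner, Finset.mul_sum]
    refine HasDerivAt.fun_sum fun n _ => HasDerivAt.fun_sum fun i _ => ?_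
    have hn : HasDerivAt (fun τ => D τ n) (deriv (fun τ => D τ n) t) t :=
      (differentiableAt_pi.1 (hD t) n).hasDerivAt
    have hi := (hasDerivAt_pi.1 hn i).fun_pow 2
    refine hi.congr_deriv ?_
    norm_num
    ring
  set c := γ / 2 - ε with hc
  have hder2 : ∀ t, HasDerivAt (fun τ => bnorm (D τ) ^ 2 * Real.exp (2 * c * τ))
      (2 * binner (D t) (fun n => deriv (fun τ => D τ n) t) * Real.exp (2 * c * t)
        + bnorm (D t) ^ 2 * (Real.exp (2 * c * t) * (2 * c))) t := by
    intro t
    have he : HasDerivAt (fun τ : ℝ => 2 * c * τ) (2 * c) t := by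
      simpa using (hasDerivAt_id t).const_mul (2 * c)
    exact (hder t).mul he.exp
  have hanti : AntitoneOn (fun τ => bnorm (D τ) ^ 2 * Real.exp (2 * c * τ)) (Set.Ici 0) := by
    refine antitoneOn_of_deriv_nonpos (convex_Ici 0)
      (fun t _ => (hder2 t).continuousAt.continuousWithinAt)
      (fun t _ => (hder2 t).differentiableAt.differentiableWithinAt) fun t ht => ?_
    rw [interior_Ici] at ht
    rw [(hder2 t).deriv]
    have := key t (le_of_lt ht)
    have := mul_le_mul_of_nonneg_right this (Real.exp_pos (2 * c * t)).le
    linarith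
  intro t ht
  have h := hanti (Set.mem_Ici.2 le_rfl) (Set.mem_Ici.2 ht) ht
  simp only [mul_zero, Real.exp_zero, mul_one] at h
  have hE : Real.exp (2 * c * t) = Real.exp (c * t) ^ 2 := by
    rw [← Real.exp_nat_mul]
    congr 1
    push_cast
    ring
  rw [hE, ← mul_pow] at h
  have h0 : bnorm (D t) * Real.exp (c * t) ≤ bnorm (D 0) :=
    (sq_le_sq₀ (mul_nonneg (Real.sqrt_nonneg _) (Real.exp_pos _).le) (Real.sqrt_nonneg _)).1 h
  rw [neg_mul, Real.exp_neg, ← div_eq_mul_inv]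
  exact (le_div_iff₀ (Real.exp_pos _)).2 h0
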